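/- Let G = ⟨a,b_1,…,b_r⟩ be a multi-GGS-group. Then the abelianization G/G′ is isomorphic to the elementary abelian group C_p^{r+1}. -/

import Mathlib

/-!
Automorphisms of the `p`-regular rooted tree, encoded by portraits:
an automorphism is a family of permutations of `Fin p`, one for each vertex
(vertices are finite words over `Fin p`, the root being `[]`).
-/

namespace TreeAut

variable {p : ℕ}

/-- Automorphisms of the `p`-regular rooted tree, given by their portraits. -/
def AutT (p : ℕ) : Type := List (Fin p) → Equiv.Perm (Fin p)

namespace AutT

/-- The action of a tree automorphism on the vertices (finite words over `Fin p`). -/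
def act : AutT p → List (Fin p) → List (Fin p)
  | _, [] => []
  | f, x :: w => f [] x :: act (fun v => f (x :: v)) w

/-- The section of `f` at the level-one vertex `x`; the map
`f ↦ (sections f 0, …, sections f (p-1))` restricted to the first-level
stabilizer is the isomorphism `ψ`. -/
def sections (f : AutT p) : Fin p → AutT p := fun x v => f (x :: v)

instance : One (AutT p) := ⟨fun _ => 1⟩

instance : Mul (AutT p) := ⟨fun f g v => f (act g v) * g v⟩

/-- The action of the inverse automorphism on vertices. -/
def invAct : AutT p → List (Fin p) → List (Fin p)
  | _, [] => []
  | f, x :: w => (f [])⁻¹ x :: invAct (fun v => f (((f [])⁻¹ x) :: v)) w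

instance : Inv (AutT p) := ⟨fun f v => (f (invAct f v))⁻¹⟩

lemma one_apply (v : List (Fin p)) : (1 : AutT p) v = 1 := rfl

lemma mul_apply (f g : AutT p) (v : List (Fin p)) : (f * g) v = f (act g v) * g v := rfl

lemma inv_apply (f : AutT p) (v : List (Fin p)) : f⁻¹ v = (f (invAct f v))⁻¹ := rfl

lemma act_nil (f : AutT p) : act f [] = [] := rfl

lemma act_cons (f : AutT p) (x : Fin p) (w : List (Fin p)) :
    act f (x :: w) = f [] x :: act (sections f x) w := rfl

lemma sections_mul (f g : AutT p) (x : Fin p) :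
    sections (f * g) x = sections f (g [] x) * sections g x :=
  funext fun _ => rfl

lemma act_one : ∀ v : List (Fin p), act (1 : AutT p) v = v
  | [] => rfl
  | x :: w => congrArg (x :: ·) (act_one w)

lemma act_mul (f g : AutT p) : ∀ v : List (Fin p), act (f * g) v = act f (act g v)
  | [] => rfl
  | x :: w => by
      rw [act_cons (f * g), sections_mul, act_mul, act_cons g, act_cons f]
      rfl

lemma invAct_act (f : AutT p) : ∀ v : List (Fin p), invAct f (act f v) = v
  | [] => rfl
  | x :: w => by
      rw [act_cons]
      show (f [])⁻¹ (f [] x) ::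
          invAct (fun v => f (((f [])⁻¹ (f [] x)) :: v)) (act (sections f x) w) = x :: w
      rw [show (f [])⁻¹ (f [] x) = x from (f []).symm_apply_apply x]
      exact congrArg (x :: ·) (invAct_act (sections f x) w)

instance : Group (AutT p) where
  mul_assoc f g h := by
    funext v
    show (f * g) (act h v) * h v = f (act (g * h) v) * (g * h) v
    rw [mul_apply, mul_apply, act_mul, mul_assoc]
  one_mul f := by
    funext v
    show (1 : AutT p) (act f v) * f v = f v
    rw [one_apply, one_mul]
  mul_one f := by
    funext v
    show f (act (1 : AutT p) v) * (1 : AutT p) v = f v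
    rw [act_one, one_apply, mul_one]
  inv_mul_cancel f := by
    funext v
    show f⁻¹ (act f v) * f v = (1 : AutT p) v
    rw [inv_apply, invAct_act, one_apply, inv_mul_cancel]

lemma act_length (f : AutT p) : ∀ v : List (Fin p), (act f v).length = v.length
  | [] => rfl
  | _ :: w => congrArg Nat.succ (act_length _ w)

lemma act_act_inv (f : AutT p) (v : List (Fin p)) : act f (act f⁻¹ v) = v := by
  rw [← act_mul, mul_inv_cancel, act_one]

/-- The pointwise stabilizer `st(n)` of the `n`-th level of the tree. -/
def levelStab (p n : ℕ) : Subgroup (AutT p) where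
  carrier := {f | ∀ v : List (Fin p), v.length = n → act f v = v}
  one_mem' := fun v _ => act_one v
  mul_mem' := by
    intro f g hf hg v hv
    rw [act_mul, hg v hv, hf v hv]
  inv_mem' := by
    intro f hf v hv
    have h1 : act f (act f⁻¹ v) = v := act_act_inv f v
    have h2 : act f (act f⁻¹ v) = act f⁻¹ v := hf _ (by rw [act_length, hv])
    exact h2.symm.trans h1

instance levelStab_normal (p n : ℕ) : (levelStab p n).Normal := by
  constructor
  intro f hf g v hv
  show act (g * f * g⁻¹) v = v
  rw [act_mul, act_mul, hf _ (by rw [act_length, hv]), act_act_inv]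

/-- The tuple of sections at the level-two vertices.  Restricted to the
second-level stabilizer this is the map `ψ₂`. -/
def sections2 (f : AutT p) : Fin p → Fin p → AutT p := fun x y v => f (x :: y :: v)

/-- The rooted automorphism defined by a permutation `σ` of `Fin p`. -/
def rooted (σ : Equiv.Perm (Fin p)) : AutT p := fun v => if v = [] then σ else 1

/-- The rooted automorphism `a`, acting at the root by the cycle `(1 2 … p)`. -/
def rootedA (p : ℕ) : AutT p := rooted (finRotate p)

/-- Auxiliary portrait for the directed automorphism `b_e`. -/
def directedAux (e : Fin (p - 1) → ZMod p) : List (Fin p) → Equiv.Perm (Fin p)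
  | [] => 1
  | x :: w =>
      if h : (x : ℕ) < p - 1 then
        (if w = [] then finRotate p ^ ((e ⟨x, h⟩).val) else 1)
      else directedAux e w

/-- The directed automorphism `b_e` defined by the vector `e ∈ 𝔽_p^{p-1}`,
i.e. the unique automorphism with `ψ(b_e) = (a^{e_1}, …, a^{e_{p-1}}, b_e)`. -/
def directed (e : Fin (p - 1) → ZMod p) : AutT p := directedAux e

/-- The multi-GGS-group determined by the vectors `e 1, …, e r`. -/
def multiGGS (p : ℕ) {r : ℕ} (e : Fin r → Fin (p - 1) → ZMod p) : Subgroup (AutT p) :=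
  Subgroup.closure ({rootedA p} ∪ Set.range fun i => directed (e i))

/-- The GGS-group `𝒢` defined by the (nonzero) constant vector `(c, …, c)`. -/
def constGGS (p : ℕ) (c : ZMod p) : Subgroup (AutT p) :=
  Subgroup.closure {rootedA p, directed (fun _ => c)}

/-- `G` is the GGS-group `𝒢` defined by a constant vector. -/
def IsConstGGS {p : ℕ} (G : Subgroup (AutT p)) : Prop :=
  ∃ c : ZMod p, c ≠ 0 ∧ G = constGGS p c

/-- The stabilizer `st_G(n) = G ∩ st(n)`, viewed as a subgroup of `G`. -/
def stabIn {p : ℕ} (G : Subgroup (AutT p)) (n : ℕ) : Subgroup G :=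
  (levelStab p n).comap G.subtype

instance {p : ℕ} (G : Subgroup (AutT p)) (n : ℕ) : (stabIn G n).Normal :=
  Subgroup.Normal.comap (levelStab_normal p n) G.subtype

/-- The congruence subgroup property: every finite-index subgroup of `G`
contains a level stabilizer `st_G(n)`. -/
def HasCSP {p : ℕ} (G : Subgroup (AutT p)) : Prop :=
  ∀ H : Subgroup G, H.FiniteIndex → ∃ n : ℕ, stabIn G n ≤ H

/-- `G` is just infinite: it is infinite and all its nontrivial normal
subgroups have finite index. -/
def JustInfinite {p : ℕ} (G : Subgroup (AutT p)) : Prop :=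
  Infinite G ∧ ∀ N : Subgroup G, N.Normal → N ≠ ⊥ → N.FiniteIndex

end AutT

end TreeAut

namespace TreeAut

namespace AutT

variable {p : ℕ}

lemma ext_of_sections {f g : AutT p} (h₀ : f [] = g [])
    (h : ∀ x, sections f x = sections g x) : f = g := by
  funext v
  cases v with
  | nil => exact h₀
  | cons x w => exact congrFun (h x) w

lemma mul_root (f g : AutT p) : (f * g) [] = f [] * g [] := rfl

lemma finRotate_pow_val (k : ℕ) (x : Fin p) :
    ((finRotate p ^ k) x : ℕ) = (x + k) % p := by
  induction k with
  | zero => simp [Nat.mod_eq_of_lt x.2]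
  | succ k ih =>
    rw [pow_succ', Equiv.Perm.mul_apply]
    obtain _ | n := p
    · exact x.elim0
    · rw [finRotate_apply, Fin.val_add, ih, Fin.val_one', Nat.add_mod_mod, Nat.mod_add_mod,
        add_assoc]

/-- The power of the cycle `(1 2 … p)` with exponent `k ∈ ZMod p`. -/
def rot (k : ZMod p) : Equiv.Perm (Fin p) := finRotate p ^ k.val

lemma rot_val (k : ZMod p) (x : Fin p) : (rot k x : ℕ) = (x + k.val) % p :=
  finRotate_pow_val _ _

lemma rot_zero : rot (0 : ZMod p) = 1 := by
  cases p <;> simp [rot]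

lemma rot_add [NeZero p] (k l : ZMod p) : rot (k + l) = rot k * rot l := by
  ext x
  rw [Equiv.Perm.mul_apply, rot_val, rot_val, rot_val, ZMod.val_add, Nat.add_mod_mod,
    Nat.mod_add_mod, add_comm k.val, add_assoc]

lemma rot_apply_injective [NeZero p] (x : Fin p) :
    Function.Injective fun k : ZMod p => rot k x := by
  intro k l h
  have h' : (x + k.val) % p = (x + l.val) % p := by
    rw [← rot_val, ← rot_val]; exact congrArg Fin.val h
  have h'' : k.val ≡ l.val [MOD p] := Nat.ModEq.add_left_cancel' (x : ℕ) h'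
  exact ZMod.val_injective p (h''.eq_of_lt_of_lt k.val_lt l.val_lt)

lemma rot_eq_one [NeZero p] {k : ZMod p} (h : rot k = 1) : k = 0 :=
  rot_apply_injective (0 : Fin p) (by simp only [h, rot_zero])

lemma sections_rooted (σ : Equiv.Perm (Fin p)) (x : Fin p) : sections (rooted σ) x = 1 := rfl

lemma rooted_one : rooted (1 : Equiv.Perm (Fin p)) = 1 :=
  ext_of_sections rfl fun _ => rfl

lemma rooted_mul (σ τ : Equiv.Perm (Fin p)) : rooted (σ * τ) = rooted σ * rooted τ :=
  ext_of_sections rfl fun x => by simp [sections_mul, sections_rooted]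

/-- The power of the rooted automorphism `a` with exponent `k ∈ ZMod p`. -/
def rootedPow (k : ZMod p) : AutT p := rooted (rot k)

lemma rootedPow_root (k : ZMod p) : rootedPow k [] = rot k := rfl

lemma sections_rootedPow (k : ZMod p) (x : Fin p) : sections (rootedPow k) x = 1 := rfl

lemma rootedPow_zero : rootedPow (0 : ZMod p) = 1 := by
  rw [rootedPow, rot_zero, rooted_one]

lemma rootedPow_add [NeZero p] (k l : ZMod p) :
    rootedPow (k + l) = rootedPow k * rootedPow l := by
  rw [rootedPow, rot_add, rooted_mul]; rfl

lemma rootedPow_neg [NeZero p] (k : ZMod p) : rootedPow (-k) = (rootedPow k)⁻¹ :=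
  eq_inv_of_mul_eq_one_left (by rw [← rootedPow_add, neg_add_cancel, rootedPow_zero])

lemma rootedPow_one [Fact p.Prime] : rootedPow (1 : ZMod p) = rootedA p := by
  rw [rootedPow, rot, ZMod.val_one, pow_one, rootedA]

lemma directed_root (v : Fin (p - 1) → ZMod p) : directed v [] = 1 := rfl

lemma sections_directed_of_lt (v : Fin (p - 1) → ZMod p) {x : Fin p} (h : (x : ℕ) < p - 1) :
    sections (directed v) x = rootedPow (v ⟨x, h⟩) := by
  funext w
  simp [sections, directed, directedAux, h, rootedPow, rooted, rot]

lemma sections_directed_of_not_lt (v : Fin (p - 1) → ZMod p) {x : Fin p}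
    (h : ¬ (x : ℕ) < p - 1) : sections (directed v) x = directed v := by
  funext w
  simp [sections, directed, directedAux, h]

lemma directed_zero : directed (0 : Fin (p - 1) → ZMod p) = 1 := by
  funext w
  induction w with
  | nil => rfl
  | cons x w ih =>
    change sections (directed 0) x w = 1
    by_cases h : (x : ℕ) < p - 1
    · rw [sections_directed_of_lt _ h, Pi.zero_apply, rootedPow_zero, one_apply]
    · rw [sections_directed_of_not_lt _ h, ih, one_apply]

lemma directed_add [NeZero p] (u v : Fin (p - 1) → ZMod p) :
    directed (u + v) = directed u * directed v := by
  funext w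
  induction w with
  | nil => rfl
  | cons x w ih =>
    change sections (directed (u + v)) x w = sections (directed u * directed v) x w
    rw [sections_mul, directed_root, Equiv.Perm.one_apply]
    by_cases h : (x : ℕ) < p - 1
    · simp only [sections_directed_of_lt _ h, Pi.add_apply, rootedPow_add]
    · simp only [sections_directed_of_not_lt _ h, ih]

lemma directed_neg [NeZero p] (v : Fin (p - 1) → ZMod p) : directed (-v) = (directed v)⁻¹ :=
  eq_inv_of_mul_eq_one_left (by rw [← directed_add, neg_add_cancel, directed_zero])

lemma directed_eq_one [NeZero p] {v : Fin (p - 1) → ZMod p} (h : directed v = 1) : v = 0 := by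
  funext i
  have hi : (i : ℕ) < p - 1 := i.2
  have h' := sections_directed_of_lt v (x := ⟨i, by omega⟩) hi
  rw [h] at h'
  exact rot_eq_one (congrFun h' []).symm

/-- The conjugate `a ^ c * b_v * a ^ (-c)`. -/
def directedConj (c : ZMod p) (v : Fin (p - 1) → ZMod p) : AutT p :=
  rootedPow c * directed v * rootedPow (-c)

lemma directedConj_zero_left (v : Fin (p - 1) → ZMod p) : directedConj 0 v = directed v := by
  simp [directedConj, rootedPow_zero]

lemma directedConj_root [NeZero p] (c : ZMod p) (v : Fin (p - 1) → ZMod p) :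
    directedConj c v [] = 1 := by
  rw [directedConj, mul_root, mul_root, directed_root, mul_one, rootedPow_root, rootedPow_root,
    ← rot_add, add_neg_cancel, rot_zero]

lemma directedConj_add [NeZero p] (c : ZMod p) (u v : Fin (p - 1) → ZMod p) :
    directedConj c (u + v) = directedConj c u * directedConj c v := by
  simp [directedConj, directed_add, rootedPow_neg, mul_assoc]

lemma directedConj_eq_one [NeZero p] {c : ZMod p} {v : Fin (p - 1) → ZMod p}
    (h : directedConj c v = 1) : v = 0 := by
  rw [directedConj, rootedPow_neg, conj_eq_one_iff] at h
  exact directed_eq_one h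

lemma rootedPow_mul_directedConj [NeZero p] (s c : ZMod p) (v : Fin (p - 1) → ZMod p) :
    rootedPow s * directedConj c v = directedConj (s + c) v * rootedPow s := by
  simp [directedConj, rootedPow_add, rootedPow_neg, mul_assoc]

lemma sections_directedConj (c : ZMod p) (v : Fin (p - 1) → ZMod p) (x : Fin p) :
    sections (directedConj c v) x = sections (directed v) (rot (-c) x) := by
  simp [directedConj, sections_mul, sections_rootedPow, rootedPow_root]

/-- The level-one vertex at which the section of `a ^ c * b_v * a ^ (-c)` is `b_v`. -/
def spot [NeZero p] (c : ZMod p) : Fin p := rot c ⟨p - 1, Nat.sub_lt (NeZero.pos p) one_pos⟩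

lemma spot_injective [NeZero p] : Function.Injective (spot : ZMod p → Fin p) :=
  rot_apply_injective _

lemma sections_directedConj_of_eq [NeZero p] {c : ZMod p} (v : Fin (p - 1) → ZMod p) {x : Fin p}
    (h : spot c = x) : sections (directedConj c v) x = directed v := by
  rw [sections_directedConj, ← h, spot, ← Equiv.Perm.mul_apply, ← rot_add, neg_add_cancel,
    rot_zero, Equiv.Perm.one_apply, sections_directed_of_not_lt _ (by simp)]

lemma exists_sections_directedConj_of_ne [NeZero p] {c : ZMod p} (v : Fin (p - 1) → ZMod p)
    {x : Fin p} (h : spot c ≠ x) : ∃ s, sections (directedConj c v) x = rootedPow s := by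
  have hlt : (rot (-c) x : ℕ) < p - 1 := by
    by_contra hge
    apply h
    have hlast : (⟨p - 1, Nat.sub_lt (NeZero.pos p) one_pos⟩ : Fin p) = rot (-c) x := by
      apply Fin.ext
      have := (rot (-c) x).2
      simp only
      omega
    rw [spot, hlast, ← Equiv.Perm.mul_apply, ← rot_add, add_neg_cancel, rot_zero,
      Equiv.Perm.one_apply]
  exact ⟨_, (sections_directedConj c v x).trans (sections_directed_of_lt v hlt)⟩

/-- The product of the conjugates `a ^ c * b_v * a ^ (-c)` over a list of pairs `(c, v)`. -/
def conjProd (L : List (ZMod p × (Fin (p - 1) → ZMod p))) : AutT p :=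
  (L.map fun l => directedConj l.1 l.2).prod

/-- The sum of the vectors `v` over a list of pairs `(c, v)`. -/
def vecSum (L : List (ZMod p × (Fin (p - 1) → ZMod p))) : Fin (p - 1) → ZMod p :=
  (L.map Prod.snd).sum

/-- Add `s` to every first coordinate of a list of pairs. -/
def shift (s : ZMod p) (L : List (ZMod p × (Fin (p - 1) → ZMod p))) :
    List (ZMod p × (Fin (p - 1) → ZMod p)) :=
  L.map fun l => (s + l.1, l.2)

lemma conjProd_nil : conjProd ([] : List (ZMod p × (Fin (p - 1) → ZMod p))) = 1 := rfl

lemma conjProd_cons (l : ZMod p × (Fin (p - 1) → ZMod p)) (L) :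
    conjProd (l :: L) = directedConj l.1 l.2 * conjProd L := by
  simp [conjProd]

lemma conjProd_append (L L' : List (ZMod p × (Fin (p - 1) → ZMod p))) :
    conjProd (L ++ L') = conjProd L * conjProd L' := by
  simp [conjProd]

lemma vecSum_append (L L' : List (ZMod p × (Fin (p - 1) → ZMod p))) :
    vecSum (L ++ L') = vecSum L + vecSum L' := by
  simp [vecSum]

lemma vecSum_shift (s : ZMod p) (L) : vecSum (shift s L) = vecSum L := by
  simp [vecSum, shift, Function.comp_def]

lemma length_shift (s : ZMod p) (L) : (shift s L).length = L.length := by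
  simp [shift]

lemma conjProd_root [NeZero p] (L : List (ZMod p × (Fin (p - 1) → ZMod p))) :
    conjProd L [] = 1 := by
  induction L with
  | nil => rfl
  | cons l L ih => rw [conjProd_cons, mul_root, directedConj_root, ih, one_mul]

lemma rootedPow_mul_conjProd [NeZero p] (s : ZMod p) (L) :
    rootedPow s * conjProd L = conjProd (shift s L) * rootedPow s := by
  induction L with
  | nil => simp [shift, conjProd_nil]
  | cons l L ih =>
    rw [conjProd_cons, ← mul_assoc, rootedPow_mul_directedConj, mul_assoc, ih, ← mul_assoc]
    exact congrArg (· * rootedPow s) (conjProd_cons (s + l.1, l.2) (shift s L)).symm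

lemma conjProd_of_forall_eq [NeZero p] {c : ZMod p} {L : List (ZMod p × (Fin (p - 1) → ZMod p))}
    (h : ∀ l ∈ L, l.1 = c) : conjProd L = directedConj c (vecSum L) := by
  induction L with
  | nil => simp [conjProd_nil, vecSum, directedConj, directed_zero, rootedPow_neg]
  | cons l L ih =>
    rw [List.forall_mem_cons] at h
    rw [conjProd_cons, ih h.2, h.1, ← directedConj_add]
    rfl

lemma eq_zero_of_conjProd_mul_rootedPow_eq_one [NeZero p] {k : ZMod p}
    {L : List (ZMod p × (Fin (p - 1) → ZMod p))} (h : conjProd L * rootedPow k = 1) : k = 0 := by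
  apply rot_eq_one
  have := congrFun h []
  rwa [mul_root, conjProd_root, one_mul] at this

/-- A level-one section of a product of conjugates of directed automorphisms is, up to a power of
`a`, again such a product, and it involves precisely the factors located at that vertex. -/
lemma exists_sections_conjProd [NeZero p] (L : List (ZMod p × (Fin (p - 1) → ZMod p)))
    (x : Fin p) : ∃ L' k, sections (conjProd L) x = conjProd L' * rootedPow k ∧
      L'.length = L.countP (fun l => spot l.1 = x) ∧
      vecSum L' = (L.map fun l => if spot l.1 = x then l.2 else 0).sum := by
  induction L with
  | nil => exact ⟨[], 0, by rw [conjProd_nil, rootedPow_zero, mul_one]; rfl, rfl, rfl⟩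
  | cons l L ih =>
    obtain ⟨L', k, h₁, h₂, h₃⟩ := ih
    by_cases h : spot l.1 = x
    · refine ⟨(0, l.2) :: L', k, ?_, ?_, ?_⟩
      · rw [conjProd_cons, sections_mul, conjProd_root, Equiv.Perm.one_apply, h₁,
          sections_directedConj_of_eq _ h, conjProd_cons, directedConj_zero_left, mul_assoc]
      · simp [h, h₂]
      · rw [List.map_cons, List.sum_cons, ← h₃, if_pos h]
        rfl
    · obtain ⟨s, hs⟩ := exists_sections_directedConj_of_ne l.2 h
      refine ⟨shift s L', s + k, ?_, ?_, ?_⟩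
      · rw [conjProd_cons, sections_mul, conjProd_root, Equiv.Perm.one_apply, h₁, hs,
          ← mul_assoc, rootedPow_mul_conjProd, mul_assoc, rootedPow_add]
      · simp [h, h₂, length_shift]
      · simp [h, h₃, vecSum_shift]

lemma sum_sum_ite_spot [NeZero p] (L : List (ZMod p × (Fin (p - 1) → ZMod p))) :
    ∑ x, (L.map fun l => if spot l.1 = x then l.2 else 0).sum = vecSum L := by
  induction L with
  | nil => simp [vecSum]
  | cons l L ih =>
    simp only [List.map_cons, List.sum_cons, Finset.sum_add_distrib, ih]
    simp [vecSum]

/-- The relations between the conjugates of directed automorphisms are homogeneous. -/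
theorem vecSum_eq_zero [NeZero p] (L : List (ZMod p × (Fin (p - 1) → ZMod p)))
    (hL : conjProd L = 1) : vecSum L = 0 := by
  induction hn : L.length using Nat.strong_induction_on generalizing L with
  | _ n ih =>
  by_cases hx : ∃ x : Fin p, ∀ l ∈ L, spot l.1 = x
  · obtain ⟨x, hx⟩ := hx
    have hc : ∃ c, ∀ l ∈ L, l.1 = c := by
      cases L with
      | nil => exact ⟨0, by simp⟩
      | cons l L =>
        refine ⟨l.1, fun m hm => spot_injective ?_⟩
        exact (hx m hm).trans (hx l List.mem_cons_self).symm
    obtain ⟨c, hc⟩ := hc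
    rw [conjProd_of_forall_eq hc] at hL
    exact directedConj_eq_one hL
  · push Not at hx
    rw [← sum_sum_ite_spot]
    refine Finset.sum_eq_zero fun x _ => ?_
    obtain ⟨L', k, h₁, h₂, h₃⟩ := exists_sections_conjProd L x
    rw [hL, show sections (1 : AutT p) x = 1 from rfl] at h₁
    have hk := eq_zero_of_conjProd_mul_rootedPow_eq_one h₁.symm
    rw [hk, rootedPow_zero, mul_one] at h₁
    rw [← h₃]
    refine ih _ ?_ L' h₁.symm rfl
    rw [h₂, ← hn]
    refine lt_of_le_of_ne List.countP_le_length fun heq => ?_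
    obtain ⟨l, hl, hne⟩ := hx x
    exact hne (by simpa using List.countP_eq_length.1 heq l hl)

/-- The generators `a, b_1, …, b_r` of the multi-GGS-group, as a family indexed by
`Fin (r + 1)`. -/
def gen (p : ℕ) {r : ℕ} (e : Fin r → Fin (p - 1) → ZMod p) : Fin (r + 1) → AutT p :=
  Fin.cons (rootedA p) fun i => directed (e i)

lemma multiGGS_eq_closure {r : ℕ} (e : Fin r → Fin (p - 1) → ZMod p) :
    multiGGS p e = Subgroup.closure (Set.range (gen p e)) := by
  rw [gen, Fin.range_cons, multiGGS, Set.singleton_union]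

lemma rootedPow_pow [NeZero p] (k : ZMod p) (n : ℕ) :
    rootedPow k ^ n = rootedPow (n • k) := by
  induction n with
  | zero => simp [rootedPow_zero]
  | succ n ih => rw [pow_succ, ih, succ_nsmul, rootedPow_add]

lemma directed_pow [NeZero p] (v : Fin (p - 1) → ZMod p) (n : ℕ) :
    directed v ^ n = directed (n • v) := by
  induction n with
  | zero => simp [directed_zero]
  | succ n ih => rw [pow_succ, ih, succ_nsmul, directed_add]

lemma gen_pow [Fact p.Prime] {r : ℕ} (e : Fin r → Fin (p - 1) → ZMod p) (i : Fin (r + 1)) :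
    gen p e i ^ p = 1 := by
  cases i using Fin.cases with
  | zero => simp [gen, ← rootedPow_one, rootedPow_pow, rootedPow_zero]
  | succ i =>
    have : p • e i = 0 := by ext; simp
    simp [gen, directed_pow, this, directed_zero]

/-- The exponent-sum homomorphism of the free group, with exponents modulo `p`. -/
def expSum (p n : ℕ) : FreeGroup (Fin n) →* (Fin n → Multiplicative (ZMod p)) :=
  FreeGroup.lift fun i => Pi.mulSingle i (Multiplicative.ofAdd 1)

lemma expSum_surjective (p n : ℕ) [NeZero p] : Function.Surjective (expSum p n) := by
  rw [← MonoidHom.range_eq_top, eq_top_iff]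
  intro x _
  rw [← Finset.univ_prod_mulSingle x]
  refine Subgroup.prod_mem _ fun i _ => ⟨FreeGroup.of i ^ (x i).toAdd.val, ?_⟩
  rw [map_pow, expSum, FreeGroup.lift_apply_of, ← Pi.mulSingle_pow, ← ofAdd_nsmul]
  simp

/-- Normal form of the value of a word in the generators of a multi-GGS-group. -/
lemma exists_lift_gen_eq [Fact p.Prime] {r : ℕ} (e : Fin r → Fin (p - 1) → ZMod p)
    (w : FreeGroup (Fin (r + 1))) :
    ∃ L, FreeGroup.lift (gen p e) w =
        conjProd L * rootedPow (expSum p (r + 1) w 0).toAdd ∧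
      vecSum L = ∑ i : Fin r, (expSum p (r + 1) w i.succ).toAdd • e i := by
  have hof (i : Fin (r + 1)) :
      expSum p (r + 1) (FreeGroup.of i) = Pi.mulSingle i (Multiplicative.ofAdd 1) :=
    FreeGroup.lift_apply_of
  induction w using FreeGroup.induction_on with
  | C1 => exact ⟨[], by simp [conjProd_nil, rootedPow_zero], by simp [vecSum]⟩
  | of i =>
    cases i using Fin.cases with
    | zero => exact ⟨[], by simp [conjProd_nil, hof, gen, rootedPow_one], by simp [vecSum, hof]⟩
    | succ i =>
      refine ⟨[(0, e i)], ?_, ?_⟩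
      · simp [conjProd, hof, gen, directedConj_zero_left, rootedPow_zero]
      · simp [vecSum, hof, Pi.mulSingle_apply, apply_ite, ite_smul]
  | inv_of i _ =>
    cases i using Fin.cases with
    | zero =>
      exact ⟨[], by simp [conjProd_nil, hof, gen, rootedPow_one, rootedPow_neg],
        by simp [vecSum, hof]⟩
    | succ i =>
      refine ⟨[(0, -e i)], ?_, ?_⟩
      · simp [conjProd, hof, gen, directedConj_zero_left, rootedPow_zero, directed_neg]
      · simp [vecSum, hof, Pi.mulSingle_apply, apply_ite, ite_smul]
  | mul u w hu hw =>
    obtain ⟨L, hL, hL'⟩ := hu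
    obtain ⟨M, hM, hM'⟩ := hw
    refine ⟨L ++ shift (expSum p (r + 1) u 0).toAdd M, ?_, ?_⟩
    · rw [map_mul, hL, hM, map_mul, Pi.mul_apply, toAdd_mul, rootedPow_add, conjProd_append]
      simp only [mul_assoc]
      rw [← mul_assoc (rootedPow _) (conjProd M), rootedPow_mul_conjProd, mul_assoc]
    · simp [vecSum_append, vecSum_shift, hL', hM', add_smul, Finset.sum_add_distrib]

/-- A relation between the generators of a multi-GGS-group has trivial exponent sums. -/
theorem expSum_eq_one [Fact p.Prime] {r : ℕ} {e : Fin r → Fin (p - 1) → ZMod p}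
    (he : LinearIndependent (ZMod p) e) {w : FreeGroup (Fin (r + 1))}
    (hw : FreeGroup.lift (gen p e) w = 1) : expSum p (r + 1) w = 1 := by
  obtain ⟨L, h₁, h₂⟩ := exists_lift_gen_eq e w
  rw [hw] at h₁
  have hk := eq_zero_of_conjProd_mul_rootedPow_eq_one h₁.symm
  rw [hk, rootedPow_zero, mul_one] at h₁
  rw [vecSum_eq_zero L h₁.symm] at h₂
  funext i
  cases i using Fin.cases with
  | zero => exact hk
  | succ i => exact Fintype.linearIndependent_iff.1 he _ h₂.symm i

/-- If a group is generated by `n` elements of order dividing `p`, all of whose relations have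
trivial exponent sums modulo `p`, then its abelianization is isomorphic to `C_p^n`. -/
theorem nonempty_abelianization_mulEquiv {G : Type*} [Group G] {p n : ℕ} [NeZero p]
    (φ : FreeGroup (Fin n) →* G) (hφ : Function.Surjective φ)
    (hpow : ∀ i, φ (FreeGroup.of i) ^ p = 1) (hker : φ.ker ≤ (expSum p n).ker) :
    Nonempty (Abelianization G ≃* (Fin n → Multiplicative (ZMod p))) := by
  let θ : G →* (Fin n → Multiplicative (ZMod p)) := φ.liftOfSurjective hφ ⟨expSum p n, hker⟩
  have hθ (w) : θ (φ w) = expSum p n w := φ.liftOfRightInverse_comp_apply _ _ _ w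
  let Θ := Abelianization.lift θ
  have hrel (i : Fin n) : zmultiplesHom _ (Additive.ofMul (Abelianization.of
      (φ (FreeGroup.of i)))) (p : ℤ) = 0 := by
    rw [zmultiplesHom_apply, natCast_zsmul, ← ofMul_pow, ← map_pow, hpow, map_one, ofMul_one]
  let ρ (i : Fin n) : Multiplicative (ZMod p) →* Abelianization G :=
    AddMonoidHom.toMultiplicativeLeft (ZMod.lift p
      ⟨zmultiplesHom _ (Additive.ofMul (Abelianization.of (φ (FreeGroup.of i)))), hrel i⟩)
  have hρ (i) : ρ i (Multiplicative.ofAdd 1) = Abelianization.of (φ (FreeGroup.of i)) := by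
    have := ZMod.lift_coe p
      ⟨zmultiplesHom _ (Additive.ofMul (Abelianization.of (φ (FreeGroup.of i)))), hrel i⟩ 1
    rw [Int.cast_one] at this
    exact this.trans (one_zsmul _)
  let R : (Fin n → Multiplicative (ZMod p)) →* Abelianization G :=
    ∏ i, (ρ i).comp (Pi.evalMonoidHom _ i)
  have hR : (R.comp (expSum p n)) = Abelianization.of.comp φ := by
    ext i
    simp only [MonoidHom.comp_apply, R, MonoidHom.finsetProd_apply, Pi.evalMonoidHom_apply, expSum,
      FreeGroup.lift_apply_of]
    rw [Finset.prod_eq_single i (fun j _ hj => by rw [Pi.mulSingle_eq_of_ne hj, map_one]) (by simp),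
      Pi.mulSingle_eq_same, hρ]
  refine ⟨MulEquiv.ofBijective Θ ⟨?_, fun x => ?_⟩⟩
  · apply Function.LeftInverse.injective (g := R)
    intro q
    obtain ⟨g, rfl⟩ : ∃ g, Abelianization.of g = q := QuotientGroup.mk_surjective q
    obtain ⟨w, rfl⟩ := hφ g
    rw [Abelianization.lift_apply_of, hθ]
    exact DFunLike.congr_fun hR w
  · obtain ⟨w, rfl⟩ := expSum_surjective p n x
    exact ⟨Abelianization.of (φ w), by rw [Abelianization.lift_apply_of, hθ]⟩

end AutT

end TreeAut

open TreeAut AutT Subgroup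

/-- For a multi-GGS-group `G` with `r` directed generators, the
abelianization `G/G'` is isomorphic to `C_p^(r+1)`. -/
theorem abelianization_iso
    (p r : ℕ) (hp : p.Prime) (hpodd : Odd p) (hr : 1 ≤ r)
    (e : Fin r → Fin (p - 1) → ZMod p) (he : LinearIndependent (ZMod p) e) :
    Nonempty (Abelianization (multiGGS p e) ≃* (Fin (r + 1) → Multiplicative (ZMod p))) := by
  have : Fact p.Prime := ⟨hp⟩
  have hrange : (FreeGroup.lift (gen p e)).range = multiGGS p e := by
    rw [multiGGS_eq_closure, FreeGroup.range_lift_eq_closure]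
  rw [← hrange]
  refine nonempty_abelianization_mulEquiv (FreeGroup.lift (gen p e)).rangeRestrict
    (MonoidHom.rangeRestrict_surjective _) (fun i => Subtype.ext ?_) fun w hw => ?_
  · simpa using gen_pow e i
  · rw [MonoidHom.ker_rangeRestrict] at hw
    exact expSum_eq_one he hw
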